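/- arXiv:2603.03082 — 3 statements merged into one kernel-verified Lean document; each statement's English description precedes it below -/
import Mathlib

section
/- Under the uniform local ℓ_p stability assumption, the safe robust domain of uniform attraction D̃ is an open subset of ℝ^n. -/
open Metric Set Filter Topology TopologicalSpace ENNReal

noncomputable section

abbrev Euc (n : ℕ) : Type := EuclideanSpace ℝ (Fin n)

/-- Trajectory of the discrete-time uncertain system `x_{k+1} = f (x_k) (w_k)`. -/
def traj {n m : ℕ} (f : Euc n → Euc m → Euc n) (x : Euc n) (π : ℕ → Euc m) : ℕ → Euc n
  | 0 => x
  | k + 1 => f (traj f x π k) (π k)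

/-- Reachable set of `X` at time `k` under disturbance signals taking values in `W`. -/
def reach {n m : ℕ} (f : Euc n → Euc m → Euc n) (W : Set (Euc m)) (X : Set (Euc n)) (k : ℕ) :
    Set (Euc n) :=
  {y | ∃ x ∈ X, ∃ π : ℕ → Euc m, (∀ j, π j ∈ W) ∧ y = traj f x π k}

/-- The one-step set-valued map `F(X) = {f x w : x ∈ X, w ∈ W}`. -/
def Fmap {n m : ℕ} (f : Euc n → Euc m → Euc n) (W : Set (Euc m)) (X : Set (Euc n)) :
    Set (Euc n) :=
  Set.image2 f X W

/-- Asymmetric (directed) Hausdorff distance `sup_{x ∈ A} dist(x, B)`. -/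
def dHa {n : ℕ} (A B : Set (Euc n)) : ℝ := ⨆ x : A, Metric.infDist (x : Euc n) B

/-- Uniform local ℓ_p stability of the robust invariant set `𝒜` within the safe set `𝒳`. -/
structure LpStable {n m : ℕ} (f : Euc n → Euc m → Euc n) (W : Set (Euc m))
    (𝒳 𝒜 : Set (Euc n)) where
  r : ℝ
  M : ℝ
  p : ℝ
  lam : ℝ → ℕ → ℝ
  r_pos : 0 < r
  M_ge_one : 1 ≤ M
  p_pos : 0 < p
  lam_nonneg : ∀ s ∈ Set.Icc (0 : ℝ) r, ∀ k : ℕ, 0 ≤ lam s k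
  lam_cont : ∀ k : ℕ, ContinuousOn (fun s => lam s k) (Set.Icc (0 : ℝ) r)
  lam_mono : ∀ k : ℕ, MonotoneOn (fun s => lam s k) (Set.Icc (0 : ℝ) r)
  lam_zero : ∀ k : ℕ, lam 0 k = 0
  lam_anti : ∀ s ∈ Set.Icc (0 : ℝ) r, ∀ k l : ℕ, k ≤ l → lam s l ≤ lam s k
  lam_le_id : ∀ s ∈ Set.Icc (0 : ℝ) r, lam s 0 ≤ s
  lam_summable : Summable fun k : ℕ => lam r k ^ p
  stab : ∀ x ∈ 𝒳, Metric.infDist x 𝒜 ≤ r →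
    ∀ π : ℕ → Euc m, (∀ j, π j ∈ W) →
      ∀ k : ℕ, Metric.infDist (traj f x π k) 𝒜 ≤ M * lam (Metric.infDist x 𝒜) k

/-- The safe robust domain of uniform attraction. -/
def DOUA {n m : ℕ} (f : Euc n → Euc m → Euc n) (W : Set (Euc m)) (𝒳 𝒜 : Set (Euc n)) :
    Set (Euc n) :=
  {x | (∀ k : ℕ, reach f W {x} k ⊆ 𝒳) ∧
    Filter.Tendsto (fun k => dHa (reach f W {x} k) 𝒜) Filter.atTop (nhds 0)}

/-- The safe robust domain of attraction. -/
def DOA {n m : ℕ} (f : Euc n → Euc m → Euc n) (W : Set (Euc m)) (𝒳 𝒜 : Set (Euc n)) :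
    Set (Euc n) :=
  {x | ∀ π : ℕ → Euc m, (∀ j, π j ∈ W) →
    (∀ k : ℕ, traj f x π k ∈ 𝒳) ∧
      Filter.Tendsto (fun k => Metric.infDist (traj f x π k) 𝒜) Filter.atTop (nhds 0)}

/-- `Ψ(X) = (sup_{y∈X} γ y) * (sup_{y∈X} α y)`. -/
def Psi {n : ℕ} (α : Euc n → ℝ) (γ : Euc n → ℝ≥0∞) (X : Set (Euc n)) : ℝ≥0∞ :=
  (⨆ y : X, γ (y : Euc n)) * ENNReal.ofReal (⨆ y : X, α (y : Euc n))

/-- The value function `V(X) = Σ_k Ψ(R(X,k))`. -/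
def Vval {n m : ℕ} (f : Euc n → Euc m → Euc n) (W : Set (Euc m)) (α : Euc n → ℝ)
    (γ : Euc n → ℝ≥0∞) (X : Set (Euc n)) : ℝ≥0∞ :=
  ∑' k : ℕ, Psi α γ (reach f W X k)

/-- `exp(-a)` for `a ∈ [0,∞]`, with `exp(-∞) = 0`. -/
def expNeg (a : ℝ≥0∞) : ℝ := if a = ⊤ then 0 else Real.exp (-a.toReal)

/-- The value function `W(X) = 1 - exp(-V(X))`. -/
def Wval {n m : ℕ} (f : Euc n → Euc m → Euc n) (W : Set (Euc m)) (α : Euc n → ℝ)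
    (γ : Euc n → ℝ≥0∞) (X : Set (Euc n)) : ℝ :=
  1 - expNeg (Vval f W α γ X)

/-- `ξ(X) = 1 - exp(-Ψ(X))`. -/
def xival {n : ℕ} (α : Euc n → ℝ) (γ : Euc n → ℝ≥0∞) (X : Set (Euc n)) : ℝ :=
  1 - expNeg (Psi α γ X)

/-- `β(X) = exp(Ψ(X)) - 1`. -/
def betaval {n : ℕ} (α : Euc n → ℝ) (γ : Euc n → ℝ≥0∞) (X : Set (Euc n)) : ℝ :=
  Real.exp ((Psi α γ X).toReal) - 1

/-- Conditions on `α`: continuous with `α̲ dist(x,𝒜)^p̄ ≤ α(x) ≤ ᾱ dist(x,𝒜)^p̄`. -/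
def AlphaHyp {n : ℕ} (𝒜 : Set (Euc n)) (α : Euc n → ℝ) (αlow αup pbar : ℝ) : Prop :=
  Continuous α ∧ 0 < αlow ∧ αlow ≤ αup ∧
    ∀ x : Euc n, αlow * Metric.infDist x 𝒜 ^ pbar ≤ α x ∧
      α x ≤ αup * Metric.infDist x 𝒜 ^ pbar

/-- Conditions on `γ`: finite, continuous and `≥ γ̲ > 0` on `𝒳`, `= ∞` outside `𝒳`,
blowing up along sequences converging to the boundary of `𝒳`. -/
def GammaHyp {n : ℕ} (𝒳 : Set (Euc n)) (γ : Euc n → ℝ≥0∞) (γlow : ℝ) : Prop :=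
  (∀ x ∈ 𝒳, γ x ≠ ⊤) ∧ ContinuousOn γ 𝒳 ∧ 0 < γlow ∧
    (∀ x ∈ 𝒳, ENNReal.ofReal γlow ≤ γ x) ∧
    (∀ x ∉ 𝒳, γ x = ⊤) ∧
    ∀ (u : ℕ → Euc n) (x : Euc n), x ∈ frontier 𝒳 →
      Filter.Tendsto u Filter.atTop (nhds x) →
      Filter.Tendsto (fun k => γ (u k)) Filter.atTop (nhds ⊤)

theorem traj_cont {n m : ℕ} (f : Euc n → Euc m → Euc n)
    (hf : Continuous fun p : Euc n × Euc m => f p.1 p.2) (k : ℕ) :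
    Continuous fun q : Euc n × (ℕ → Euc m) => traj f q.1 q.2 k := by
  induction k with
  | zero => exact continuous_fst
  | succ k ih =>
    have h2 : Continuous fun q : Euc n × (ℕ → Euc m) => q.2 k :=
      (continuous_apply k).comp continuous_snd
    exact hf.comp (ih.prodMk h2)

theorem traj_add {n m : ℕ} (f : Euc n → Euc m → Euc n) (x : Euc n) (π : ℕ → Euc m) (K j : ℕ) :
    traj f x π (K + j) = traj f (traj f x π K) (fun i => π (K + i)) j := by
  induction j with
  | zero => rfl
  | succ j ih =>
    rw [← Nat.add_assoc]
    simp only [traj]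
    rw [ih]

theorem sig_compact {m : ℕ} (W : Set (Euc m)) (hW : IsCompact W) :
    IsCompact {π : ℕ → Euc m | ∀ j, π j ∈ W} := by
  have := isCompact_univ_pi (X := fun _ : ℕ => Euc m) (s := fun _ => W) (fun _ => hW)
  convert this using 1
  ext π; simp

theorem ev_traj {n m : ℕ} (f : Euc n → Euc m → Euc n)
    (hf : Continuous fun p : Euc n × Euc m => f p.1 p.2) (W : Set (Euc m)) (hW : IsCompact W)
    (U : Set (Euc n)) (hU : IsOpen U) (k : ℕ) (x : Euc n)
    (hx : ∀ π : ℕ → Euc m, (∀ j, π j ∈ W) → traj f x π k ∈ U) :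
    ∀ᶠ y in 𝓝 x, ∀ π : ℕ → Euc m, (∀ j, π j ∈ W) → traj f y π k ∈ U := by
  refine (sig_compact W hW).eventually_forall_of_forall_eventually
    (P := fun y π => traj f y π k ∈ U) ?_
  intro π hπ
  exact (traj_cont f hf k).continuousAt.eventually (hU.mem_nhds (hx π hπ))

theorem reach_bdd {n m : ℕ} (f : Euc n → Euc m → Euc n)
    (hf : Continuous fun p : Euc n × Euc m => f p.1 p.2) (W : Set (Euc m)) (hW : IsCompact W)
    (A : Set (Euc n)) (x : Euc n) (k : ℕ) (π : ℕ → Euc m) (hπ : ∀ j, π j ∈ W) :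
    Metric.infDist (traj f x π k) A ≤ dHa (reach f W {x} k) A := by
  have hc : Continuous fun π : ℕ → Euc m => Metric.infDist (traj f x π k) A :=
    (Metric.continuous_infDist_pt A).comp
      ((traj_cont f hf k).comp (Continuous.prodMk continuous_const continuous_id))
  obtain ⟨B, hB⟩ := ((sig_compact W hW).image hc).bddAbove
  have hb : BddAbove (Set.range fun y : reach f W {x} k => Metric.infDist (y : Euc n) A) := by
    refine ⟨B, ?_⟩
    rintro _ ⟨⟨y, x', hx', π', hπ', rfl⟩, rfl⟩
    rw [Set.mem_singleton_iff] at hx'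
    subst hx'
    exact hB ⟨π', hπ', rfl⟩
  exact le_ciSup hb ⟨traj f x π k, x, rfl, π, hπ, rfl⟩

theorem stmt4 {n m : ℕ}
    (f : Euc n → Euc m → Euc n) (hf : Continuous fun p : Euc n × Euc m => f p.1 p.2)
    (Wd : Set (Euc m)) (hWne : Wd.Nonempty) (hWc : IsCompact Wd)
    (𝒳 : Set (Euc n)) (h𝒳 : IsOpen 𝒳)
    (𝒜 : Set (Euc n)) (h𝒜ne : 𝒜.Nonempty) (h𝒜c : IsCompact 𝒜) (h𝒜𝒳 : 𝒜 ⊆ 𝒳)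
    (h𝒜inv : ∀ x ∈ 𝒜, ∀ w ∈ Wd, f x w ∈ 𝒜)
    (H : LpStable f Wd 𝒳 𝒜)
    : IsOpen (DOUA f Wd 𝒳 𝒜) := by
  have hr := H.r_pos
  have hM : 0 < H.M := lt_of_lt_of_le one_pos H.M_ge_one
  obtain ⟨ε, hε, hεX⟩ := h𝒜c.exists_thickening_subset_open h𝒳 h𝒜𝒳
  set δ : ℝ := min H.r (ε / H.M) with hδ
  have hδ0 : 0 < δ := lt_min hr (div_pos hε hM)
  have hrm : H.r ∈ Set.Icc (0 : ℝ) H.r := ⟨hr.le, le_rfl⟩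
  have hlim : Tendsto (fun j => H.M * H.lam H.r j) atTop (𝓝 0) := by
    have h1 := H.lam_summable.tendsto_atTop_zero
    have h2 : Tendsto (fun j => (H.lam H.r j ^ H.p) ^ (H.p⁻¹)) atTop (𝓝 ((0 : ℝ) ^ (H.p⁻¹))) :=
      h1.rpow_const (Or.inr (inv_pos.2 H.p_pos).le)
    rw [Real.zero_rpow (inv_pos.2 H.p_pos).ne'] at h2
    have h3 : (fun j => (H.lam H.r j ^ H.p) ^ (H.p⁻¹)) = fun j => H.lam H.r j := by
      funext j
      exact Real.rpow_rpow_inv (H.lam_nonneg _ hrm j) H.p_pos.ne'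
    rw [h3] at h2
    simpa using h2.const_mul H.M
  rw [isOpen_iff_mem_nhds]
  rintro x ⟨hxX, hxA⟩
  obtain ⟨K, hK⟩ := (hxA.eventually (gt_mem_nhds hδ0)).exists
  have e1 : ∀ᶠ y in 𝓝 x, ∀ k ∈ Finset.range (K + 1), ∀ π : ℕ → Euc m, (∀ j, π j ∈ Wd) →
      traj f y π k ∈ 𝒳 := by
    rw [Filter.eventually_all_finset]
    intro k _
    exact ev_traj f hf Wd hWc 𝒳 h𝒳 k x fun π hπ => hxX k ⟨x, rfl, π, hπ, rfl⟩
  have e2 := ev_traj f hf Wd hWc {y | Metric.infDist y 𝒜 < δ}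
    (isOpen_lt (Metric.continuous_infDist_pt 𝒜) continuous_const) K x
    fun π hπ => lt_of_le_of_lt (reach_bdd f hf Wd hWc 𝒜 x K π hπ) hK
  filter_upwards [e1, e2] with y h1 h2
  have key : ∀ π : ℕ → Euc m, (∀ j, π j ∈ Wd) → ∀ j,
      Metric.infDist (traj f y π (K + j)) 𝒜 ≤ H.M * H.lam H.r j ∧ traj f y π (K + j) ∈ 𝒳 := by
    intro π hπ j
    have hd : Metric.infDist (traj f y π K) 𝒜 < δ := h2 π hπ
    have hdr : Metric.infDist (traj f y π K) 𝒜 ≤ H.r := hd.le.trans (min_le_left _ _)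
    have hs : Metric.infDist (traj f y π K) 𝒜 ∈ Set.Icc (0 : ℝ) H.r :=
      ⟨Metric.infDist_nonneg, hdr⟩
    have hst := H.stab _ (h1 K (by simp) π hπ) hdr (fun i => π (K + i)) (fun i => hπ _) j
    rw [← traj_add] at hst
    refine ⟨hst.trans (mul_le_mul_of_nonneg_left (H.lam_mono j hs hrm hdr) hM.le), hεX ?_⟩
    rw [Metric.mem_thickening_iff, ← Metric.infDist_lt_iff h𝒜ne]
    have h0 := (H.lam_anti _ hs 0 j (Nat.zero_le j)).trans (H.lam_le_id _ hs)
    have hd2 : Metric.infDist (traj f y π K) 𝒜 < ε / H.M := hd.trans_le (min_le_right _ _)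
    rw [lt_div_iff₀ hM] at hd2
    have h3 := mul_le_mul_of_nonneg_left h0 hM.le
    linarith
  have hne : ∀ k, Nonempty (reach f Wd {y} k) := fun k => by
    obtain ⟨w, hw⟩ := hWne
    exact ⟨⟨_, y, rfl, fun _ => w, fun _ => hw, rfl⟩⟩
  refine ⟨?_, ?_⟩
  · rintro k _ ⟨y', hy', π, hπ, rfl⟩
    rw [Set.mem_singleton_iff] at hy'
    subst hy'
    rcases le_total k K with h | h
    · exact h1 k (by simp; omega) π hπ
    · obtain ⟨j, rfl⟩ := Nat.exists_eq_add_of_le h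
      exact (key π hπ j).2
  · rw [← tendsto_add_atTop_iff_nat K]
    refine squeeze_zero (fun j => Real.iSup_nonneg fun _ => Metric.infDist_nonneg) (fun j => ?_) hlim
    haveI := hne (j + K)
    refine ciSup_le ?_
    rintro ⟨_, y', hy', π, hπ, rfl⟩
    rw [Set.mem_singleton_iff] at hy'
    subst hy'
    rw [Nat.add_comm]
    exact (key π hπ j).1

end
end

section
/- Under the uniform local ℓ_p stability assumption and the stated conditions on α and γ, the following three sets coincide: {x ∈ ℝ^n : V({x}) < ∞} = {x ∈ ℝ^n : W({x}) < 1} = D̃. -/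
open Metric Set Filter Topology TopologicalSpace ENNReal

noncomputable section

theorem aux_traj_cont {n m : ℕ} (f : Euc n → Euc m → Euc n)
    (hf : Continuous fun p : Euc n × Euc m => f p.1 p.2) (x : Euc n) (k : ℕ) :
    Continuous fun π : ℕ → Euc m => traj f x π k := by
  induction k with
  | zero => exact continuous_const
  | succ k ih => exact hf.comp (ih.prodMk (continuous_apply k))

theorem aux_reach_eq {n m : ℕ} (f : Euc n → Euc m → Euc n) (Wd : Set (Euc m)) (x : Euc n)
    (k : ℕ) : reach f Wd {x} k = (fun π : ℕ → Euc m => traj f x π k) '' (Set.univ.pi fun _ => Wd) := by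
  ext y
  simp only [reach, Set.mem_ofPred_eq, Set.mem_image, Set.mem_univ_pi, Set.mem_singleton_iff,
    exists_eq_left]
  exact ⟨fun ⟨π, h, e⟩ => ⟨π, h, e.symm⟩, fun ⟨π, h, e⟩ => ⟨π, h, e.symm⟩⟩

theorem aux_reach_compact {n m : ℕ} (f : Euc n → Euc m → Euc n)
    (hf : Continuous fun p : Euc n × Euc m => f p.1 p.2) (Wd : Set (Euc m)) (hWc : IsCompact Wd)
    (x : Euc n) (k : ℕ) : IsCompact (reach f Wd {x} k) := by
  rw [aux_reach_eq]
  exact (isCompact_univ_pi fun _ => hWc).image (aux_traj_cont f hf x k)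

theorem aux_reach_ne {n m : ℕ} (f : Euc n → Euc m → Euc n) (Wd : Set (Euc m))
    (hWne : Wd.Nonempty) (x : Euc n) (k : ℕ) : (reach f Wd {x} k).Nonempty := by
  obtain ⟨w, hw⟩ := hWne
  exact ⟨_, x, rfl, fun _ => w, fun _ => hw, rfl⟩

theorem aux_shift {n m : ℕ} (f : Euc n → Euc m → Euc n) (x : Euc n) (π : ℕ → Euc m) (N j : ℕ) :
    traj f x π (j + N) = traj f (traj f x π N) (fun i => π (i + N)) j := by
  induction j with
  | zero => simp [traj]
  | succ j ih =>
    rw [show j + 1 + N = (j + N) + 1 by omega]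
    simp only [traj, ih]

theorem aux_bdd {n : ℕ} {S : Set (Euc n)} (hS : IsCompact S) {g : Euc n → ℝ}
    (hg : Continuous g) : BddAbove (Set.range fun y : S => g y) := by
  have := hS.bddAbove_image hg.continuousOn
  rwa [Set.image_eq_range] at this

theorem aux_W_lt {a : ℝ≥0∞} : a < ⊤ ↔ 1 - expNeg a < 1 := by
  unfold expNeg
  split_ifs with h
  · simp [h]
  · simp [lt_top_iff_ne_top, h, Real.exp_pos]

theorem aux_gamma_bdd {n : ℕ} {𝒳 K : Set (Euc n)} {γ : Euc n → ℝ≥0∞}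
    (h1 : ∀ x ∈ 𝒳, γ x ≠ ⊤) (h2 : ContinuousOn γ 𝒳) (hK : IsCompact K) (hKX : K ⊆ 𝒳) :
    ∃ C : ℝ≥0∞, C ≠ ⊤ ∧ ∀ y ∈ K, γ y ≤ C := by
  rcases K.eq_empty_or_nonempty with rfl | hne
  · exact ⟨0, by simp, by simp⟩
  · obtain ⟨z, hz, hm⟩ := hK.exists_isMaxOn hne (h2.mono hKX)
    exact ⟨γ z, h1 z (hKX hz), fun y hy => hm hy⟩

theorem aux_forward {n m : ℕ}
    (f : Euc n → Euc m → Euc n) (hf : Continuous fun p : Euc n × Euc m => f p.1 p.2)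
    (Wd : Set (Euc m)) (hWne : Wd.Nonempty) (hWc : IsCompact Wd)
    (𝒳 : Set (Euc n))
    (𝒜 : Set (Euc n)) (h𝒜ne : 𝒜.Nonempty) (h𝒜c : IsCompact 𝒜) (h𝒜𝒳 : 𝒜 ⊆ 𝒳)
    (α : Euc n → ℝ) (αlow αup pbar : ℝ) (hα : AlphaHyp 𝒜 α αlow αup pbar)
    (hp : 0 < pbar)
    (γ : Euc n → ℝ≥0∞) (γlow : ℝ) (hγ : GammaHyp 𝒳 γ γlow) (x : Euc n)
    (hV : Vval f Wd α γ {x} < ⊤) : x ∈ DOUA f Wd 𝒳 𝒜 := by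
  obtain ⟨hαc, hαl, hαlu, hαb⟩ := hα
  obtain ⟨hγ1, hγ2, hγl, hγ3, hγ4, -⟩ := hγ
  have hK := aux_reach_compact f hf Wd hWc x
  have hne := aux_reach_ne f Wd hWne x
  have hle : ∀ k, ∀ y ∈ reach f Wd {x} k, α y ≤ ⨆ y : reach f Wd {x} k, α y :=
    fun k y hy => le_ciSup (aux_bdd (hK k) hαc) (⟨y, hy⟩ : reach f Wd {x} k)
  have hsafe : ∀ k, reach f Wd {x} k ⊆ 𝒳 := by
    intro k y hy
    by_contra hyX
    have hPsi : Psi α γ (reach f Wd {x} k) ≠ ⊤ := ENNReal.ne_top_of_tsum_ne_top hV.ne k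
    apply hPsi
    have htop : (⨆ y : reach f Wd {x} k, γ (y : Euc n)) = ⊤ := by
      rw [eq_top_iff, ← hγ4 y hyX]
      exact le_iSup (fun y : reach f Wd {x} k => γ (y : Euc n)) ⟨y, hy⟩
    have hyA : y ∉ 𝒜 := fun h => hyX (h𝒜𝒳 h)
    have hd : 0 < Metric.infDist y 𝒜 :=
      (h𝒜c.isClosed.notMem_iff_infDist_pos h𝒜ne).1 hyA
    have hαy : 0 < α y := lt_of_lt_of_le (by positivity) (hαb y).1
    unfold Psi
    rw [htop]
    exact ENNReal.top_mul (ENNReal.ofReal_pos.2 (hαy.trans_le (hle k y hy))).ne'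
  refine ⟨hsafe, ?_⟩
  have hPsi0 : Tendsto (fun k => Psi α γ (reach f Wd {x} k)) atTop (𝓝 0) :=
    ENNReal.tendsto_atTop_zero_of_tsum_ne_top hV.ne
  rw [Metric.tendsto_atTop]
  intro ε hε
  set c : ℝ := γlow * (αlow * (ε / 2) ^ pbar) with hc
  have hcpos : 0 < c := by positivity
  obtain ⟨N, hN⟩ := eventually_atTop.1
    (hPsi0.eventually (gt_mem_nhds (ENNReal.ofReal_pos.2 hcpos)))
  refine ⟨N, fun k hk => ?_⟩
  have hnn : 0 ≤ dHa (reach f Wd {x} k) 𝒜 := Real.iSup_nonneg fun _ => Metric.infDist_nonneg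
  rw [Real.dist_eq, sub_zero, abs_of_nonneg hnn]
  have : Nonempty (reach f Wd {x} k) := (hne k).to_subtype
  suffices dHa (reach f Wd {x} k) 𝒜 ≤ ε / 2 by linarith
  refine ciSup_le fun y => ?_
  by_contra! hcon
  have h1 : αlow * (ε / 2) ^ pbar ≤ ⨆ y : reach f Wd {x} k, α y := by
    refine le_trans ?_ ((hαb y).1.trans (hle k y y.2))
    have := Real.rpow_le_rpow (by positivity) hcon.le hp.le
    gcongr
  have h2 : ENNReal.ofReal c ≤ Psi α γ (reach f Wd {x} k) := by
    rw [hc, ENNReal.ofReal_mul hγl.le]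
    exact mul_le_mul' ((hγ3 y (hsafe k y.2)).trans
      (le_iSup (fun y : reach f Wd {x} k => γ (y : Euc n)) y)) (ENNReal.ofReal_le_ofReal h1)
  exact absurd (hN k hk) (not_lt.2 h2)

theorem aux_backward {n m : ℕ}
    (f : Euc n → Euc m → Euc n) (hf : Continuous fun p : Euc n × Euc m => f p.1 p.2)
    (Wd : Set (Euc m)) (hWne : Wd.Nonempty) (hWc : IsCompact Wd)
    (𝒳 : Set (Euc n)) (h𝒳 : IsOpen 𝒳)
    (𝒜 : Set (Euc n)) (h𝒜ne : 𝒜.Nonempty) (h𝒜c : IsCompact 𝒜) (h𝒜𝒳 : 𝒜 ⊆ 𝒳)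
    (H : LpStable f Wd 𝒳 𝒜)
    (α : Euc n → ℝ) (αlow αup pbar : ℝ) (hα : AlphaHyp 𝒜 α αlow αup pbar)
    (hpbar : H.p ≤ pbar)
    (γ : Euc n → ℝ≥0∞) (γlow : ℝ) (hγ : GammaHyp 𝒳 γ γlow) (x : Euc n)
    (hx : x ∈ DOUA f Wd 𝒳 𝒜) : Vval f Wd α γ {x} < ⊤ := by
  obtain ⟨hαc, hαl, hαlu, hαb⟩ := hα
  obtain ⟨hγ1, hγ2, hγl, hγ3, hγ4, -⟩ := hγ
  obtain ⟨hsafe, hlim⟩ := hx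
  have hK := aux_reach_compact f hf Wd hWc x
  have hne := aux_reach_ne f Wd hWne x
  have hp : 0 < pbar := H.p_pos.trans_le hpbar
  have hαup : 0 < αup := hαl.trans_le hαlu
  obtain ⟨ε, hε, hεX⟩ := h𝒜c.exists_cthickening_subset_open h𝒳 h𝒜𝒳
  obtain ⟨C, hC, hCb⟩ := aux_gamma_bdd hγ1 hγ2 h𝒜c.cthickening hεX
  have hmin : 0 < min ε H.r := lt_min hε H.r_pos
  obtain ⟨N, hN⟩ := eventually_atTop.1 (hlim.eventually (gt_mem_nhds hmin))
  have hdist : ∀ k ≥ N, ∀ y ∈ reach f Wd {x} k, Metric.infDist y 𝒜 ≤ min ε H.r := by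
    intro k hk y hy
    refine le_trans ?_ (hN k hk).le
    exact le_ciSup (aux_bdd (hK k) (Metric.continuous_infDist_pt 𝒜))
      (⟨y, hy⟩ : reach f Wd {x} k)
  have hr : H.r ∈ Set.Icc (0 : ℝ) H.r := ⟨H.r_pos.le, le_rfl⟩
  have hM : 0 < H.M := one_pos.trans_le H.M_ge_one
  have hdec : ∀ j, ∀ y ∈ reach f Wd {x} (j + N), Metric.infDist y 𝒜 ≤ H.M * H.lam H.r j := by
    rintro j y ⟨x', rfl, π, hπ, rfl⟩
    have hz : traj f x' π N ∈ reach f Wd {x'} N := ⟨x', rfl, π, hπ, rfl⟩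
    have hzr := (hdist N le_rfl _ hz).trans (min_le_right _ _)
    rw [aux_shift]
    refine (H.stab _ (hsafe N hz) hzr _ (fun i => hπ _) j).trans ?_
    exact mul_le_mul_of_nonneg_left
      (H.lam_mono j ⟨Metric.infDist_nonneg, hzr⟩ hr hzr) hM.le
  have hfin : ∀ k, Psi α γ (reach f Wd {x} k) ≠ ⊤ := by
    intro k
    obtain ⟨D, hD, hDb⟩ := aux_gamma_bdd hγ1 hγ2 (hK k) (hsafe k)
    refine ENNReal.mul_ne_top ?_ ENNReal.ofReal_ne_top
    exact ne_top_of_le_ne_top hD (iSup_le fun y => hDb y y.2)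
  set B : ℝ := αup * H.M ^ pbar * H.r ^ (pbar - H.p) with hB
  have hBnn : 0 ≤ B := by have := H.r_pos; positivity
  have htail : ∀ j, Psi α γ (reach f Wd {x} (j + N)) ≤
      C * ENNReal.ofReal (B * H.lam H.r j ^ H.p) := by
    intro j
    have : Nonempty (reach f Wd {x} (j + N)) := (hne _).to_subtype
    refine mul_le_mul' (iSup_le fun y => hCb y ?_) (ENNReal.ofReal_le_ofReal (ciSup_le fun y => ?_))
    · obtain ⟨z, hz, hzd⟩ := h𝒜c.exists_infDist_eq_dist h𝒜ne (y : Euc n)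
      exact Metric.mem_cthickening_of_dist_le _ z _ _ hz
        (hzd ▸ (hdist _ (by omega) y y.2).trans (min_le_left _ _))
    · have hl0 := H.lam_nonneg _ hr j
      have hlr : H.lam H.r j ≤ H.r := (H.lam_anti _ hr 0 j (Nat.zero_le _)).trans (H.lam_le_id _ hr)
      have e : H.lam H.r j ^ pbar ≤ H.r ^ (pbar - H.p) * H.lam H.r j ^ H.p := by
        have : H.lam H.r j ^ pbar = H.lam H.r j ^ (pbar - H.p) * H.lam H.r j ^ H.p := by
          rw [← Real.rpow_add_of_nonneg hl0 (by linarith) H.p_pos.le, sub_add_cancel]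
        rw [this]
        exact mul_le_mul_of_nonneg_right (Real.rpow_le_rpow hl0 hlr (by linarith))
          (Real.rpow_nonneg hl0 _)
      calc α y ≤ αup * Metric.infDist (y : Euc n) 𝒜 ^ pbar := (hαb y).2
        _ ≤ αup * (H.M * H.lam H.r j) ^ pbar :=
          mul_le_mul_of_nonneg_left
            (Real.rpow_le_rpow Metric.infDist_nonneg (hdec j y y.2) hp.le) hαup.le
        _ = αup * H.M ^ pbar * H.lam H.r j ^ pbar := by
          rw [Real.mul_rpow hM.le hl0, mul_assoc]
        _ ≤ αup * H.M ^ pbar * (H.r ^ (pbar - H.p) * H.lam H.r j ^ H.p) :=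
          mul_le_mul_of_nonneg_left e (by positivity)
        _ = B * H.lam H.r j ^ H.p := by rw [hB]; ring
  have hsum : ∑' j, Psi α γ (reach f Wd {x} (j + N)) ≠ ⊤ := by
    refine ne_top_of_le_ne_top ?_ (ENNReal.tsum_le_tsum htail)
    rw [ENNReal.tsum_mul_left]
    exact ENNReal.mul_ne_top hC (H.lam_summable.mul_left B).tsum_ofReal_ne_top
  unfold Vval
  rw [← ENNReal.summable.sum_add_tsum_nat_add' (k := N)]
  exact ENNReal.add_lt_top.2 ⟨ENNReal.sum_lt_top.2 fun k _ => (hfin k).lt_top, hsum.lt_top⟩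

theorem stmt8 {n m : ℕ}
    (f : Euc n → Euc m → Euc n) (hf : Continuous fun p : Euc n × Euc m => f p.1 p.2)
    (Wd : Set (Euc m)) (hWne : Wd.Nonempty) (hWc : IsCompact Wd)
    (𝒳 : Set (Euc n)) (h𝒳 : IsOpen 𝒳)
    (𝒜 : Set (Euc n)) (h𝒜ne : 𝒜.Nonempty) (h𝒜c : IsCompact 𝒜) (h𝒜𝒳 : 𝒜 ⊆ 𝒳)
    (h𝒜inv : ∀ x ∈ 𝒜, ∀ w ∈ Wd, f x w ∈ 𝒜)
    (H : LpStable f Wd 𝒳 𝒜)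
    (α : Euc n → ℝ) (αlow αup pbar : ℝ) (hα : AlphaHyp 𝒜 α αlow αup pbar)
    (hpbar : H.p ≤ pbar)
    (γ : Euc n → ℝ≥0∞) (γlow : ℝ) (hγ : GammaHyp 𝒳 γ γlow)
    : {x : Euc n | Vval f Wd α γ {x} < ⊤} = {x : Euc n | Wval f Wd α γ {x} < 1} ∧
      {x : Euc n | Wval f Wd α γ {x} < 1} = DOUA f Wd 𝒳 𝒜 := by
  have h1 : {x : Euc n | Vval f Wd α γ {x} < ⊤} = {x : Euc n | Wval f Wd α γ {x} < 1} := by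
    ext x
    exact aux_W_lt
  refine ⟨h1, ?_⟩
  rw [← h1]
  ext x
  exact ⟨aux_forward f hf Wd hWne hWc 𝒳 𝒜 h𝒜ne h𝒜c h𝒜𝒳 α αlow αup pbar hα
      (H.p_pos.trans_le hpbar) γ γlow hγ x,
    aux_backward f hf Wd hWne hWc 𝒳 h𝒳 𝒜 h𝒜ne h𝒜c h𝒜𝒳 H α αlow αup pbar hα hpbar γ γlow hγ x⟩


end
end

section
/- The value function W satisfies the Zubov-type functional equation W(X) − W(F(X)) = ξ(X)·(1 − W(F(X))) for every nonempty compact X ⊆ ℝ^n, where ξ(X) := 1 − exp(−Ψ(X)). -/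
open Metric Set Filter Topology TopologicalSpace ENNReal

noncomputable section

theorem traj_shift {n m : ℕ} (f : Euc n → Euc m → Euc n) (x : Euc n) (π : ℕ → Euc m) (k : ℕ) :
    traj f x π (k + 1) = traj f (f x (π 0)) (fun j => π (j + 1)) k := by
  induction k with
  | zero => rfl
  | succ k ih =>
    show f (traj f x π (k + 1)) (π (k + 1)) = _
    rw [ih]
    rfl

theorem reach_zero' {n m : ℕ} (f : Euc n → Euc m → Euc n) (W : Set (Euc m)) (hW : W.Nonempty)
    (X : Set (Euc n)) : reach f W X 0 = X := by
  obtain ⟨w, hw⟩ := hW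
  ext y
  constructor
  · rintro ⟨x, hx, π, _, rfl⟩
    exact hx
  · intro hy
    exact ⟨y, hy, fun _ => w, fun _ => hw, rfl⟩

theorem reach_succ' {n m : ℕ} (f : Euc n → Euc m → Euc n) (W : Set (Euc m))
    (X : Set (Euc n)) (k : ℕ) : reach f W X (k + 1) = reach f W (Fmap f W X) k := by
  ext y
  constructor
  · rintro ⟨x, hx, π, hπ, rfl⟩
    exact ⟨f x (π 0), ⟨x, hx, π 0, hπ 0, rfl⟩, fun j => π (j + 1), fun j => hπ (j + 1),
      traj_shift f x π k⟩
  · rintro ⟨_, ⟨x, hx, w, hw, rfl⟩, π, hπ, rfl⟩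
    refine ⟨x, hx, fun j => Nat.casesOn j w π, ?_, ?_⟩
    · intro j
      cases j with
      | zero => exact hw
      | succ j => exact hπ j
    · exact (traj_shift f x (fun j => Nat.casesOn j w π) k).symm

theorem expNeg_add (a b : ℝ≥0∞) : expNeg (a + b) = expNeg a * expNeg b := by
  unfold expNeg
  by_cases ha : a = ⊤
  · simp [ha]
  by_cases hb : b = ⊤
  · simp [hb]
  simp only [ENNReal.add_eq_top, ha, hb, or_self, if_false]
  rw [ENNReal.toReal_add ha hb, neg_add, Real.exp_add]

theorem stmt14 {n m : ℕ}
    (f : Euc n → Euc m → Euc n) (hf : Continuous fun p : Euc n × Euc m => f p.1 p.2)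
    (Wd : Set (Euc m)) (hWne : Wd.Nonempty) (hWc : IsCompact Wd)
    (𝒳 : Set (Euc n)) (h𝒳 : IsOpen 𝒳)
    (𝒜 : Set (Euc n)) (h𝒜ne : 𝒜.Nonempty) (h𝒜c : IsCompact 𝒜) (h𝒜𝒳 : 𝒜 ⊆ 𝒳)
    (h𝒜inv : ∀ x ∈ 𝒜, ∀ w ∈ Wd, f x w ∈ 𝒜)
    (α : Euc n → ℝ) (hαc : Continuous α) (hαnn : ∀ x : Euc n, 0 ≤ α x)
    (γ : Euc n → ℝ≥0∞) (hγfin : ∀ x ∈ 𝒳, γ x ≠ ⊤) (hγcont : ContinuousOn γ 𝒳)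
    (hγtop : ∀ x ∉ 𝒳, γ x = ⊤)
    (X : Set (Euc n)) (hXne : X.Nonempty) (hXc : IsCompact X) :
    Wval f Wd α γ X - Wval f Wd α γ (Fmap f Wd X) =
      xival α γ X * (1 - Wval f Wd α γ (Fmap f Wd X)) := by
  have hV : Vval f Wd α γ X = Psi α γ X + Vval f Wd α γ (Fmap f Wd X) := by
    unfold Vval
    rw [tsum_eq_zero_add' ENNReal.summable, reach_zero' f Wd hWne]
    simp only [reach_succ']
  unfold Wval xival
  rw [hV, expNeg_add]
  ring

end
end
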